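/- arXiv:2310.02197 — 2 statements merged into one kernel-verified Lean document; each statement's English description precedes it below -/
import Mathlib

section
/- Let q be an even prime power, F a finite field with q elements, and m = 2. Let H₂ᵀ be the matrix over ZMod 2 whose rows are indexed by all points of F² and whose columns are indexed by all lines of EG(2,q), with entry 1 iff the point lies on the line. Then M = [ H₂ᵀ | 𝟙 | I | I ], obtained by appending an all-ones column and two copies of the q² × q² identity matrix, is self-orthogonal: M · Mᵀ = 0 over ZMod 2. -/
open Matrix

/-- A line of the Euclidean geometry `EG(m,q)`: a coset `a + F·b` of a one-dimensional
linear subspace of `F^m`, realized as a `Finset` of points. -/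
def IsLine (F : Type*) [Field F] [Fintype F] [DecidableEq F] (m : ℕ)
    (L : Finset (Fin m → F)) : Prop :=
  ∃ a b : Fin m → F, b ≠ 0 ∧ L = Finset.univ.image (fun t : F => a + t • b)

noncomputable instance (F : Type*) [Field F] [Fintype F] [DecidableEq F] (m : ℕ) :
    Fintype {L : Finset (Fin m → F) // IsLine F m L} :=
  Fintype.ofFinite _

/-- The matrix `M = [ H₂ᵀ | 𝟙 | I | I ]` over `ZMod 2`: rows indexed by all points of `F²`,
columns indexed by all lines of `EG(2,q)`, together with one all-ones column and the
columns of two copies of the `q² × q²` identity matrix. -/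
def M3 (F : Type*) [Field F] [Fintype F] [DecidableEq F] :
    Matrix (Fin 2 → F)
      ({L : Finset (Fin 2 → F) // IsLine F 2 L} ⊕ (Unit ⊕ ((Fin 2 → F) ⊕ (Fin 2 → F))))
      (ZMod 2) :=
  Matrix.of fun p c =>
    Sum.elim (fun L => if p ∈ L.1 then 1 else 0)
      (Sum.elim (fun _ => 1)
        (Sum.elim (fun w => if p = w then 1 else 0) (fun w => if p = w then 1 else 0))) c

section Directions

variable {F : Type*} [Field F]

/-- Representatives of the directions of lines in the plane: `(0, 1)` and `(1, s)`. -/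
def planeDirection : Option F → Fin 2 → F
  | none => ![0, 1]
  | some s => ![1, s]

lemma planeDirection_ne_zero (o : Option F) : planeDirection o ≠ 0 := by
  cases o with
  | none => exact fun h => one_ne_zero (congrFun h 1)
  | some s => exact fun h => one_ne_zero (congrFun h 0)

lemma eq_of_smul_planeDirection {o o' : Option F} {t : F}
    (h : t • planeDirection o = planeDirection o') : o = o' := by
  have h0 := congrFun h 0
  have h1 := congrFun h 1
  cases o <;> cases o' <;> simp_all [planeDirection]

lemma exists_smul_eq_planeDirection {b : Fin 2 → F} (hb : b ≠ 0) :
    ∃ (o : Option F) (c : F), c • b = planeDirection o := by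
  by_cases h0 : b 0 = 0
  · have h1 : b 1 ≠ 0 := fun h1 => hb (by ext i; fin_cases i <;> simp [h0, h1])
    refine ⟨none, (b 1)⁻¹, ?_⟩
    ext i
    fin_cases i <;> simp [planeDirection, h0, h1]
  · refine ⟨some ((b 0)⁻¹ * b 1), (b 0)⁻¹, ?_⟩
    ext i
    fin_cases i <;> simp [planeDirection, h0]

end Directions

/-- The line of `EG(m,q)` through `p` in the direction `b`. -/
def lineThrough {F : Type*} [Field F] [Fintype F] [DecidableEq F] {m : ℕ}
    (p b : Fin m → F) : Finset (Fin m → F) :=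
  Finset.univ.image (fun t : F => p + t • b)

section Lines

variable {F : Type*} [Field F] [Fintype F] [DecidableEq F] {m : ℕ}

lemma mem_lineThrough {p b x : Fin m → F} : x ∈ lineThrough p b ↔ ∃ t : F, p + t • b = x := by
  simp [lineThrough]

lemma isLine_lineThrough (p : Fin m → F) {b : Fin m → F} (hb : b ≠ 0) :
    IsLine F m (lineThrough p b) :=
  ⟨p, b, hb, rfl⟩

lemma self_mem_lineThrough (p b : Fin m → F) : p ∈ lineThrough p b :=
  mem_lineThrough.2 ⟨0, by simp⟩

lemma add_mem_lineThrough (p b : Fin m → F) : p + b ∈ lineThrough p b :=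
  mem_lineThrough.2 ⟨1, by simp⟩

lemma lineThrough_add_smul (a b : Fin m → F) (s : F) {c : F} (hc : c ≠ 0) :
    lineThrough (a + s • b) (c • b) = lineThrough a b := by
  ext x
  simp only [mem_lineThrough]
  constructor
  · rintro ⟨t, rfl⟩
    exact ⟨s + t * c, by module⟩
  · rintro ⟨t, rfl⟩
    refine ⟨(t - s) / c, ?_⟩
    rw [smul_smul, div_mul_cancel₀ _ hc]
    module

/-- A line is determined by any two of its points. -/
lemma IsLine.eq_lineThrough {L : Finset (Fin m → F)} (hL : IsLine F m L) {p r : Fin m → F}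
    (hp : p ∈ L) (hr : r ∈ L) (hpr : p ≠ r) : L = lineThrough p (r - p) := by
  obtain ⟨a, b, hb, rfl⟩ := hL
  obtain ⟨s, rfl⟩ := mem_lineThrough.1 hp
  obtain ⟨u, rfl⟩ := mem_lineThrough.1 hr
  have hc : u - s ≠ 0 := fun h => hpr (by rw [sub_eq_zero.1 h])
  have hd : a + u • b - (a + s • b) = (u - s) • b := by module
  rw [hd, lineThrough_add_smul a b s hc]
  rfl

lemma card_lines_through_pair {p r : Fin m → F} (hpr : p ≠ r) :
    (Finset.univ.filter
      (fun L : {L : Finset (Fin m → F) // IsLine F m L} => p ∈ L.1 ∧ r ∈ L.1)).card = 1 := by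
  have hd : r - p ≠ 0 := sub_ne_zero.2 hpr.symm
  refine Finset.card_eq_one.2 ⟨⟨lineThrough p (r - p), isLine_lineThrough p hd⟩, ?_⟩
  ext L
  simp only [Finset.mem_filter, Finset.mem_univ, true_and, Finset.mem_singleton]
  constructor
  · rintro ⟨hp, hr⟩
    exact Subtype.ext (L.2.eq_lineThrough hp hr hpr)
  · rintro rfl
    refine ⟨self_mem_lineThrough _ _, ?_⟩
    simpa using add_mem_lineThrough p (r - p)

lemma card_lines_through_point (p : Fin 2 → F) :
    (Finset.univ.filter
      (fun L : {L : Finset (Fin 2 → F) // IsLine F 2 L} => p ∈ L.1)).card =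
      Fintype.card F + 1 := by
  rw [← Fintype.card_option, ← Finset.card_univ]
  symm
  refine Finset.card_bij
    (fun o _ => ⟨lineThrough p (planeDirection o),
      isLine_lineThrough p (planeDirection_ne_zero o)⟩) ?_ ?_ ?_
  · intro o _
    simpa using self_mem_lineThrough p (planeDirection o)
  · intro o _ o' _ h
    have hmem := add_mem_lineThrough p (planeDirection o')
    rw [← show lineThrough p (planeDirection o) = lineThrough p (planeDirection o') from
      congrArg Subtype.val h] at hmem
    obtain ⟨t, ht⟩ := mem_lineThrough.1 hmem
    exact eq_of_smul_planeDirection (add_left_cancel ht)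
  · rintro ⟨L, hL⟩ hp
    replace hp : p ∈ L := by simpa using hp
    obtain ⟨a, b, hb, hLab⟩ := id hL
    change L = lineThrough a b at hLab
    obtain ⟨o, c, hc⟩ := exists_smul_eq_planeDirection hb
    have hr : p + planeDirection o ∈ L := by
      rw [hLab] at hp ⊢
      obtain ⟨s, rfl⟩ := mem_lineThrough.1 hp
      exact mem_lineThrough.2 ⟨s + c, by rw [← hc]; module⟩
    have hne : p ≠ p + planeDirection o := by simpa using planeDirection_ne_zero o
    refine ⟨o, Finset.mem_univ _, Subtype.ext ?_⟩
    simpa using (hL.eq_lineThrough hp hr hne).symm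

end Lines

theorem stmt_3 (q : ℕ) (hq : IsPrimePow q) (hqeven : Even q)
    (F : Type*) [Field F] [Fintype F] [DecidableEq F] (hcard : Fintype.card F = q) :
    M3 F * (M3 F)ᵀ = 0 := by
  have hq0 : (q : ZMod 2) = 0 := (ZMod.natCast_eq_zero_iff_even).2 hqeven
  have h_add (x : ZMod 2) : x + x = 0 := CharTwo.add_self_eq_zero x
  ext p r
  simp only [M3, Matrix.mul_apply, Matrix.transpose_apply, Matrix.of_apply, Fintype.sum_sum_type,
    Sum.elim_inl, Sum.elim_inr, Matrix.zero_apply, h_add, add_zero, ← ite_and, mul_ite, mul_one,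
    mul_zero, Finset.sum_boole, Finset.univ_unique, Finset.sum_const, Finset.card_singleton,
    one_smul]
  by_cases hpr : p = r
  · subst hpr
    simp only [and_self, card_lines_through_point, hcard, Nat.cast_add, hq0, Nat.cast_one,
      zero_add, h_add]
  · rw [card_lines_through_pair (Ne.symm hpr), Nat.cast_one, h_add]
end

section
/- Let q be an odd prime power, F a finite field with q elements, m ≥ 2, and fix b ∈ F^m with b ≠ 0. Let A be the matrix over ZMod 2 whose rows are indexed by the lines of the parallel class of direction b (the cosets a + F·b) and whose columns are indexed by all points of F^m, with entry 1 iff the point lies on the line. Then M = [ A | I ], obtained by appending a q^{m−1} × q^{m−1} identity matrix, is self-orthogonal: M · Mᵀ = 0 over ZMod 2. -/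
open Matrix

/-- A line of the parallel class of direction `b` in the Euclidean geometry `EG(m,q)`:
a coset `a + F·b` of the one-dimensional subspace `F·b`, realized as a `Finset` of points. -/
def IsParLine (F : Type*) [Field F] [Fintype F] [DecidableEq F] (m : ℕ) (b : Fin m → F)
    (L : Finset (Fin m → F)) : Prop :=
  ∃ a : Fin m → F, L = Finset.univ.image (fun t : F => a + t • b)

noncomputable instance (F : Type*) [Field F] [Fintype F] [DecidableEq F] (m : ℕ)
    (b : Fin m → F) :
    Fintype {L : Finset (Fin m → F) // IsParLine F m b L} :=
  Fintype.ofFinite _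

/-- The matrix `M = [ A | I ]` over `ZMod 2`: rows indexed by the lines of the parallel
class of direction `b`, columns indexed by all points of `F^m` together with the columns
of a `q^{m-1} × q^{m-1}` identity matrix (indexed by the lines of the class). -/
def M5 (F : Type*) [Field F] [Fintype F] [DecidableEq F] (m : ℕ) (b : Fin m → F) :
    Matrix {L : Finset (Fin m → F) // IsParLine F m b L}
      ((Fin m → F) ⊕ {L : Finset (Fin m → F) // IsParLine F m b L}) (ZMod 2) :=
  Matrix.of fun L c =>
    Sum.elim (fun p => if p ∈ L.1 then 1 else 0) (fun L' => if L = L' then 1 else 0) c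

/-- Two lines of the same direction that share a point are equal. -/
theorem IsParLine.eq_of_mem {F : Type*} [Field F] [Fintype F] [DecidableEq F] {m : ℕ}
    {b : Fin m → F} {L L' : Finset (Fin m → F)} (hL : IsParLine F m b L)
    (hL' : IsParLine F m b L') {p : Fin m → F} (hp : p ∈ L) (hp' : p ∈ L') : L = L' := by
  have key : ∀ {K : Finset (Fin m → F)}, IsParLine F m b K → p ∈ K →
      K = Finset.univ.image (fun t : F => p + t • b) := by
    rintro K ⟨a, rfl⟩ h
    obtain ⟨s, -, rfl⟩ := Finset.mem_image.1 h
    ext x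
    simp only [Finset.mem_image, Finset.mem_univ, true_and]
    constructor
    · rintro ⟨t, rfl⟩
      exact ⟨t - s, by rw [add_assoc, ← add_smul, add_sub_cancel]⟩
    · rintro ⟨t, rfl⟩
      exact ⟨s + t, by rw [add_assoc, ← add_smul]⟩
  rw [key hL hp, key hL' hp']

/-- A line with nonzero direction has as many points as the base field. -/
theorem IsParLine.card_eq {F : Type*} [Field F] [Fintype F] [DecidableEq F] {m : ℕ}
    {b : Fin m → F} (hb : b ≠ 0) {L : Finset (Fin m → F)} (hL : IsParLine F m b L) :
    L.card = Fintype.card F := by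
  obtain ⟨a, rfl⟩ := hL
  exact Finset.card_image_of_injective _
    ((add_right_injective a).comp (smul_left_injective F hb))

theorem stmt_5 (q : ℕ) (hq : IsPrimePow q) (hqodd : Odd q)
    (F : Type*) [Field F] [Fintype F] [DecidableEq F] (hcard : Fintype.card F = q)
    (m : ℕ) (hm : 2 ≤ m) (b : Fin m → F) (hb : b ≠ 0) :
    M5 F m b * (M5 F m b)ᵀ = 0 := by
  ext L L'
  simp only [Matrix.mul_apply, Matrix.transpose_apply, Fintype.sum_sum_type, M5, Matrix.of_apply,
    Sum.elim_inl, Sum.elim_inr, Matrix.zero_apply]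
  by_cases h : L = L'
  · subst h
    have hodd : ((Fintype.card F : ℕ) : ZMod 2) = 1 :=
      (ZMod.natCast_eq_one_iff_odd).2 (hcard ▸ hqodd)
    simp [IsParLine.card_eq hb L.2, hodd, CharTwo.add_self_eq_zero]
  · have hA : ∀ p : Fin m → F,
        (if p ∈ L.1 then (1 : ZMod 2) else 0) * (if p ∈ L'.1 then 1 else 0) = 0 := by
      intro p
      by_cases hp : p ∈ L.1
      · rw [if_neg fun hp' => h (Subtype.ext (L.2.eq_of_mem L'.2 hp hp')), mul_zero]
      · rw [if_neg hp, zero_mul]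
    simp [hA, h]
end
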